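/- arXiv:1810.06705 — 3 statements merged into one kernel-verified Lean document; each statement's English description precedes it below -/
import Mathlib

section
/- Let G be the 2×2 real matrix G = [[3/2, −3/4], [−3/4, 1/2]]. Then G is symmetric positive definite, and for all real numbers u and v, the quadratic form satisfies [u, v]·G·[u, v]ᵀ = (1/4)(u² + (2u − v)² + (u − v)²). -/
open Matrix

/-- The `G`-matrix of the backward Euler plus time filter method. -/
noncomputable def Gmat : Matrix (Fin 2) (Fin 2) ℝ :=
  !![3/2, -3/4; -3/4, 1/2]

/-- The quadratic form of `Gmat` is the discrete energy. -/
theorem dotProduct_Gmat_mulVec (u v : ℝ) :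
    ![u, v] ⬝ᵥ Gmat.mulVec ![u, v] = (1/4) * (u^2 + (2*u - v)^2 + (u - v)^2) := by
  simp [Gmat, Matrix.mulVec, dotProduct, Fin.sum_univ_two]
  ring

theorem Gmat_isSymm : Gmat.IsSymm := by
  ext i j
  fin_cases i <;> fin_cases j <;> simp [Gmat]

theorem Gmat_posDef : Gmat.PosDef := by
  refine Matrix.PosDef.of_dotProduct_mulVec_pos ?_ fun x hx => ?_
  · rw [Matrix.IsHermitian, Matrix.conjTranspose_eq_transpose_of_trivial]
    exact Gmat_isSymm
  · have hvec : x = ![x 0, x 1] := by ext i; fin_cases i <;> rfl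
    rw [star_trivial, hvec, dotProduct_Gmat_mulVec]
    by_contra! hle
    have h0 : x 0 = 0 := pow_eq_zero_iff two_ne_zero |>.1 <| by
      linarith [sq_nonneg (x 0), sq_nonneg (2 * x 0 - x 1), sq_nonneg (x 0 - x 1)]
    have h1 : x 1 = 0 := pow_eq_zero_iff two_ne_zero |>.1 <| by
      rw [h0] at hle
      linarith [sq_nonneg (x 1)]
    exact hx (by rw [hvec, h0, h1]; ext i; fin_cases i <;> rfl)

/-- `G` is symmetric positive definite and its quadratic form is the discrete energy
`(1/4)(u² + (2u − v)² + (u − v)²)`. -/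
theorem stmt_2 :
    Gmat.IsSymm ∧ Gmat.PosDef ∧
      ∀ u v : ℝ, ![u, v] ⬝ᵥ Gmat.mulVec ![u, v] =
        (1/4) * (u^2 + (2*u - v)^2 + (u - v)^2) := by
  exact ⟨Gmat_isSymm, Gmat_posDef, dotProduct_Gmat_mulVec⟩
end

section
/- Let E be a real inner product space (complete, so that Bochner integrals are defined), let u : ℝ → E be three times continuously differentiable, let t ∈ ℝ and Δt > 0. Then ‖((3/2)u(t + Δt) − 2u(t) + (1/2)u(t − Δt))/Δt − u′(t + Δt)‖² ≤ (6/5)·Δt³·∫_{t−Δt}^{t+Δt} ‖u′′′(s)‖² ds. -/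
/-- The Cauchy–Schwarz inequality for the integral of a scalar function times a vector function. -/
theorem sq_norm_integral_smul_le {E : Type*} [NormedAddCommGroup E] [NormedSpace ℝ E]
    {k : ℝ → ℝ} {v : ℝ → E} (hk : Continuous k) (hv : Continuous v) {a b : ℝ} (hab : a ≤ b) :
    ‖∫ s in a..b, k s • v s‖ ^ 2 ≤ (∫ s in a..b, k s ^ 2) * ∫ s in a..b, ‖v s‖ ^ 2 := by
  have hnorm : ‖∫ s in a..b, k s • v s‖ ≤ ∫ s in a..b, |k s| * ‖v s‖ := by
    simpa only [norm_smul, Real.norm_eq_abs] using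
      intervalIntegral.norm_integral_le_integral_norm (f := fun s => k s • v s)
        (μ := MeasureTheory.volume) hab
  have hquad : ∀ x : ℝ, 0 ≤ (∫ s in a..b, ‖v s‖ ^ 2) * (x * x)
      + (-2 * ∫ s in a..b, |k s| * ‖v s‖) * x + ∫ s in a..b, k s ^ 2 := by
    intro x
    have hnonneg : 0 ≤ ∫ s in a..b, (|k s| - x * ‖v s‖) ^ 2 :=
      intervalIntegral.integral_nonneg hab fun s _ => sq_nonneg _
    have hexpand : ∀ s, (|k s| - x * ‖v s‖) ^ 2
        = (x * x) * ‖v s‖ ^ 2 + (-2 * x) * (|k s| * ‖v s‖) + k s ^ 2 := by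
      intro s
      rw [← sq_abs (k s)]
      ring
    simp only [hexpand] at hnonneg
    rw [intervalIntegral.integral_add, intervalIntegral.integral_add,
      intervalIntegral.integral_const_mul, intervalIntegral.integral_const_mul] at hnonneg
    · linarith
    all_goals exact Continuous.intervalIntegrable (by fun_prop) _ _
  have hdiscrim := discrim_le_zero hquad
  have hsq := pow_le_pow_left₀ (norm_nonneg _) hnorm 2
  rw [discrim] at hdiscrim
  nlinarith

/-- Repeated integration by parts against a function with constant second derivative. -/
theorem integral_quadratic_smul_third_deriv {E : Type*} [NormedAddCommGroup E] [NormedSpace ℝ E]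
    [CompleteSpace E] {u u₁ u₂ u₃ : ℝ → E} (h₀ : ∀ s, HasDerivAt u (u₁ s) s)
    (h₁ : ∀ s, HasDerivAt u₁ (u₂ s) s) (h₂ : ∀ s, HasDerivAt u₂ (u₃ s) s) (h₃ : Continuous u₃)
    {k k₁ : ℝ → ℝ} {c : ℝ} (hk : ∀ s, HasDerivAt k (k₁ s) s) (hk₁ : ∀ s, HasDerivAt k₁ c s)
    (a b : ℝ) :
    ∫ s in a..b, k s • u₃ s
      = (k b • u₂ b - k₁ b • u₁ b + c • u b) - (k a • u₂ a - k₁ a • u₁ a + c • u a) := by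
  refine intervalIntegral.integral_eq_sub_of_hasDerivAt
    (f := fun s => k s • u₂ s - k₁ s • u₁ s + c • u s) (fun s _ => ?_) ?_
  · refine ((((hk s).smul (h₂ s)).sub ((hk₁ s).smul (h₁ s))).add
      ((h₀ s).const_smul c)).congr_deriv ?_
    module
  · have hkc : Continuous k := continuous_iff_continuousAt.2 fun s => (hk s).continuousAt
    exact (hkc.smul h₃).intervalIntegrable _ _

/-- First consistency estimate for backward Euler plus time filter:
`‖D[u(t+Δt)]/Δt − u′(t+Δt)‖² ≤ (6/5)Δt³ ∫_{t−Δt}^{t+Δt} ‖u′′′‖²`. -/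
theorem stmt_6 {E : Type*} [NormedAddCommGroup E] [InnerProductSpace ℝ E]
    [CompleteSpace E] (u : ℝ → E) (hu : ContDiff ℝ 3 u) (t Δt : ℝ) (hΔt : 0 < Δt) :
    ‖Δt⁻¹ • ((3/2 : ℝ) • u (t + Δt) - (2 : ℝ) • u t + (1/2 : ℝ) • u (t - Δt))
        - deriv u (t + Δt)‖^2 ≤
      (6/5) * Δt^3 * ∫ s in (t - Δt)..(t + Δt), ‖iteratedDeriv 3 u s‖^2 := by
  have hderiv : ∀ n : ℕ, n < 3 → ∀ s,
      HasDerivAt (iteratedDeriv n u) (iteratedDeriv (n + 1) u s) s := by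
    intro n hn s
    rw [iteratedDeriv_succ]
    exact (hu.differentiable_iteratedDeriv n (by exact_mod_cast hn) s).hasDerivAt
  have h₀ : ∀ s, HasDerivAt u (deriv u s) s := by
    simpa only [iteratedDeriv_zero, zero_add, iteratedDeriv_one] using hderiv 0 (by norm_num)
  have h₁ : ∀ s, HasDerivAt (deriv u) (iteratedDeriv 2 u s) s := by
    simpa only [iteratedDeriv_one, Nat.reduceAdd] using hderiv 1 (by norm_num)
  have h₂ : ∀ s, HasDerivAt (iteratedDeriv 2 u) (iteratedDeriv 3 u s) s :=
    hderiv 2 (by norm_num)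
  have h₃ : Continuous (iteratedDeriv 3 u) := hu.continuous_iteratedDeriv 3 le_rfl
  -- The Peano kernel of the error functional, on `[t, t + Δt]` and on `[t - Δt, t]`.
  let k : ℝ → ℝ := fun s => 3 / 4 * (t + Δt - s) ^ 2 - Δt * (t + Δt - s)
  let l : ℝ → ℝ := fun s => -(s - (t - Δt)) ^ 2 / 4
  have hk : ∀ s, HasDerivAt k (Δt - 3 / 2 * (t + Δt - s)) s := fun s => by
    have hs := (hasDerivAt_id s).const_sub (t + Δt)
    exact (((hs.pow 2).const_mul (3 / 4)).sub (hs.const_mul Δt)).congr_deriv (by simp; ring)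
  have hk₁ : ∀ s, HasDerivAt (fun s => Δt - 3 / 2 * (t + Δt - s)) (3 / 2) s := fun s => by
    have hs := (hasDerivAt_id s).const_sub (t + Δt)
    exact ((hs.const_mul (3 / 2)).const_sub Δt).congr_deriv (by simp)
  have hl : ∀ s, HasDerivAt l (-(s - (t - Δt)) / 2) s := fun s => by
    have hs := (hasDerivAt_id s).sub_const (t - Δt)
    exact ((hs.pow 2).neg.div_const 4).congr_deriv (by simp; ring)
  have hl₁ : ∀ s, HasDerivAt (fun s => -(s - (t - Δt)) / 2) (-1 / 2) s := fun s => by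
    have hs := (hasDerivAt_id s).sub_const (t - Δt)
    exact hs.neg.div_const 2
  have hkc : Continuous k := by fun_prop
  have hlc : Continuous l := by fun_prop
  have hrepr : Δt⁻¹ • ((3/2 : ℝ) • u (t + Δt) - (2 : ℝ) • u t + (1/2 : ℝ) • u (t - Δt))
      - deriv u (t + Δt) = Δt⁻¹ • ((∫ s in t..(t + Δt), k s • iteratedDeriv 3 u s)
        + ∫ s in (t - Δt)..t, l s • iteratedDeriv 3 u s) := by
    rw [integral_quadratic_smul_third_deriv h₀ h₁ h₂ h₃ hk hk₁,
      integral_quadratic_smul_third_deriv h₀ h₁ h₂ h₃ hl hl₁]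
    simp only [k, l]
    match_scalars <;> field_simp <;> ring
  have hk2 : ∫ s in t..(t + Δt), k s ^ 2 = 17 / 240 * Δt ^ 5 := by
    rw [intervalIntegral.integral_comp_sub_left
      (fun x => (3 / 4 * x ^ 2 - Δt * x) ^ 2) (t + Δt)]
    have hexp : ∀ x : ℝ, (3 / 4 * x ^ 2 - Δt * x) ^ 2
        = 9 / 16 * x ^ 4 + -(3 / 2 * Δt) * x ^ 3 + Δt ^ 2 * x ^ 2 := fun x => by ring
    simp only [hexp]
    rw [intervalIntegral.integral_add, intervalIntegral.integral_add]
    · simp only [intervalIntegral.integral_const_mul, integral_pow]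
      norm_num
      ring
    all_goals exact Continuous.intervalIntegrable (by fun_prop) _ _
  have hl2 : ∫ s in (t - Δt)..t, l s ^ 2 = 1 / 80 * Δt ^ 5 := by
    rw [intervalIntegral.integral_comp_sub_right (fun x => (-x ^ 2 / 4) ^ 2) (t - Δt)]
    have hexp : ∀ x : ℝ, (-x ^ 2 / 4) ^ 2 = 1 / 16 * x ^ 4 := fun x => by ring
    simp only [hexp, intervalIntegral.integral_const_mul, integral_pow]
    norm_num
    ring
  have hA := sq_norm_integral_smul_le hkc h₃ (show t ≤ t + Δt by linarith)
  have hB := sq_norm_integral_smul_le hlc h₃ (show t - Δt ≤ t by linarith)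
  rw [hk2] at hA
  rw [hl2] at hB
  have hint : ∀ a b, IntervalIntegrable (fun s => ‖iteratedDeriv 3 u s‖ ^ 2)
      MeasureTheory.volume a b := fun a b => (h₃.norm.pow 2).intervalIntegrable a b
  rw [hrepr, norm_smul, mul_pow, norm_inv, Real.norm_of_nonneg hΔt.le,
    ← intervalIntegral.integral_add_adjacent_intervals (hint (t - Δt) t) (hint t (t + Δt))]
  have hI₁ : 0 ≤ ∫ s in t..(t + Δt), ‖iteratedDeriv 3 u s‖ ^ 2 :=
    intervalIntegral.integral_nonneg (by linarith) fun s _ => sq_nonneg _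
  have hI₂ : 0 ≤ ∫ s in (t - Δt)..t, ‖iteratedDeriv 3 u s‖ ^ 2 :=
    intervalIntegral.integral_nonneg (by linarith) fun s _ => sq_nonneg _
  generalize (∫ s in t..(t + Δt), ‖iteratedDeriv 3 u s‖ ^ 2) = I₁ at *
  generalize (∫ s in (t - Δt)..t, ‖iteratedDeriv 3 u s‖ ^ 2) = I₂ at *
  generalize (∫ s in t..(t + Δt), k s • iteratedDeriv 3 u s) = A at *
  generalize (∫ s in (t - Δt)..t, l s • iteratedDeriv 3 u s) = B at *
  have hAB : ‖A + B‖ ^ 2 ≤ 2 * (‖A‖ ^ 2 + ‖B‖ ^ 2) :=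
    (pow_le_pow_left₀ (norm_nonneg _) (norm_add_le A B) 2).trans add_sq_le
  have h5 : 0 ≤ Δt ^ 5 := by positivity
  have hsum : ‖A + B‖ ^ 2 ≤ 6 / 5 * Δt ^ 5 * (I₂ + I₁) := by
    nlinarith [mul_nonneg h5 hI₁, mul_nonneg h5 hI₂]
  calc Δt⁻¹ ^ 2 * ‖A + B‖ ^ 2 ≤ Δt⁻¹ ^ 2 * (6 / 5 * Δt ^ 5 * (I₂ + I₁)) := by gcongr
    _ = 6 / 5 * Δt ^ 3 * (I₂ + I₁) := by field_simp
end

section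
/- Let E be a real inner product space (complete, so that Bochner integrals are defined), let u : ℝ → E be twice continuously differentiable, let t ∈ ℝ and Δt > 0. Then ‖(3/2)u(t + Δt) − u(t) + (1/2)u(t − Δt) − u(t + Δt)‖² ≤ (4/3)·Δt³·∫_{t−Δt}^{t+Δt} ‖u′′(s)‖² ds. -/
open intervalIntegral in
/-- Cauchy–Schwarz against the constant function, on an interval. -/
theorem sq_intervalIntegral_le {f : ℝ → ℝ} (hf : Continuous f) {a b : ℝ} (hab : a < b) :
    (∫ s in a..b, f s) ^ 2 ≤ (b - a) * ∫ s in a..b, f s ^ 2 := by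
  set A := ∫ s in a..b, f s with hA
  have hL : 0 < b - a := sub_pos.2 hab
  have h0 : 0 ≤ ∫ s in a..b, ((b - a) * f s - A) ^ 2 :=
    integral_nonneg hab.le fun s _ => sq_nonneg _
  have h1 : ∫ s in a..b, ((b - a) * f s - A) ^ 2 =
      (b - a) ^ 2 * (∫ s in a..b, f s ^ 2) - 2 * (b - a) * A * A + (b - a) * A ^ 2 := by
    have : ∀ s, ((b - a) * f s - A) ^ 2 =
        (b - a) ^ 2 * f s ^ 2 - 2 * (b - a) * A * f s + A ^ 2 := fun s => by ring
    simp_rw [this]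
    rw [integral_add (Continuous.intervalIntegrable (by fun_prop) _ _)
        (Continuous.intervalIntegrable (by fun_prop) _ _),
      integral_sub (Continuous.intervalIntegrable (by fun_prop) _ _)
        (Continuous.intervalIntegrable (by fun_prop) _ _),
      integral_const_mul, integral_const_mul, integral_const, smul_eq_mul]
  rw [h1] at h0
  refine le_of_mul_le_mul_left ?_ hL
  linarith

open intervalIntegral in
/-- The second difference of a `C²` function is controlled by the `L¹` norm of its second
derivative. -/
theorem norm_second_difference_le {E : Type*} [NormedAddCommGroup E] [NormedSpace ℝ E]
    [CompleteSpace E] {u : ℝ → E} (hu : ContDiff ℝ 2 u) (t : ℝ) {h : ℝ} (hh : 0 < h) :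
    ‖u (t + h) - u t - (u t - u (t - h))‖ ≤
      (∫ s in (t - h)..(t + h), ‖iteratedDeriv 2 u s‖) * h := by
  have hc : Continuous (iteratedDeriv 2 u) := hu.continuous_iteratedDeriv 2 le_rfl
  have hd : Differentiable ℝ u := hu.differentiable (by norm_num)
  have hd' : ∀ s, HasDerivAt (deriv u) (iteratedDeriv 2 u s) s := fun s => by
    have := (hu.differentiable_iteratedDeriv 1 (by norm_num)) s
    rw [iteratedDeriv_one] at this
    rw [iteratedDeriv_succ, iteratedDeriv_one]
    exact this.hasDerivAt
  have key := norm_image_sub_le_of_norm_deriv_le_segment'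
    (f := fun s => u s - u (s - h)) (f' := fun s => deriv u s - deriv u (s - h))
    (a := t) (b := t + h) (C := ∫ s in (t - h)..(t + h), ‖iteratedDeriv 2 u s‖)
    (fun s _ => ((hd s).hasDerivAt.sub
      ((hd (s - h)).hasDerivAt.comp_sub_const s h)).hasDerivWithinAt)
    (fun s hs => by
      rw [← integral_eq_sub_of_hasDerivAt (fun x _ => hd' x) (hc.intervalIntegrable _ _)]
      refine (norm_integral_le_integral_norm (by linarith)).trans ?_
      exact integral_mono_interval (by linarith [hs.1]) (by linarith) hs.2.le
        (Filter.Eventually.of_forall fun x => norm_nonneg _)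
        (hc.norm.intervalIntegrable _ _))
    (t + h) (Set.right_mem_Icc.2 (by linarith))
  simp only [add_sub_cancel_right, add_sub_cancel_left] at key
  exact key

/-- Second consistency estimate for backward Euler plus time filter:
`‖I[u(t+Δt)] − u(t+Δt)‖² ≤ (4/3)Δt³ ∫_{t−Δt}^{t+Δt} ‖u′′‖²`. -/
theorem stmt_7 {E : Type*} [NormedAddCommGroup E] [InnerProductSpace ℝ E]
    [CompleteSpace E] (u : ℝ → E) (hu : ContDiff ℝ 2 u) (t Δt : ℝ) (hΔt : 0 < Δt) :
    ‖(3/2 : ℝ) • u (t + Δt) - u t + (1/2 : ℝ) • u (t - Δt) - u (t + Δt)‖^2 ≤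
      (4/3) * Δt^3 * ∫ s in (t - Δt)..(t + Δt), ‖iteratedDeriv 2 u s‖^2 := by
  have hc : Continuous (iteratedDeriv 2 u) := hu.continuous_iteratedDeriv 2 le_rfl
  have hw : (3/2 : ℝ) • u (t + Δt) - u t + (1/2 : ℝ) • u (t - Δt) - u (t + Δt) =
      (1/2 : ℝ) • (u (t + Δt) - u t - (u t - u (t - Δt))) := by module
  have h1 := pow_le_pow_left₀ (norm_nonneg _) (norm_second_difference_le hu t hΔt) 2
  have h2 := sq_intervalIntegral_le hc.norm (show t - Δt < t + Δt by linarith)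
  have hB : 0 ≤ ∫ s in (t - Δt)..(t + Δt), ‖iteratedDeriv 2 u s‖^2 :=
    intervalIntegral.integral_nonneg (by linarith) fun s _ => sq_nonneg _
  rw [hw, norm_smul, mul_pow, Real.norm_of_nonneg (by norm_num)]
  have h3 := mul_le_mul_of_nonneg_right h2 (sq_nonneg Δt)
  have h4 := mul_nonneg (pow_pos hΔt 3).le hB
  rw [mul_pow] at h1
  linarith
end
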